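/- In any LTS, the following alternative rule is sound for branching apartness #_b: if q →_a q' for some a ∈ A and for all p',p'' with p ↠τ p' →_a p'' one has p #_b p' or q' #_b p'', then q #_b p. -/

import Mathlib

/-- `TauCl tau` is the reflexive-transitive closure `↠τ` of the silent-step relation. -/
def TauCl {X : Type*} (tau : X → X → Prop) : X → X → Prop := Relation.ReflTransGen tau

/-- `Q` is a branching apartness on the LTS `(tau, step)`. -/
def IsBranchingApartness {X A : Type*} (tau : X → X → Prop) (step : A → X → X → Prop)
    (Q : X → X → Prop) : Prop :=
  (∀ q p, Q p q → Q q p) ∧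
  (∀ q q' p, tau q q' → Q q' p →
    (∀ p' p'', TauCl tau p p' → tau p' p'' → Q q p' ∨ Q q' p'') → Q q p) ∧
  (∀ q q' p a, step a q q' →
    (∀ p' p'', TauCl tau p p' → step a p' p'' → Q q p' ∨ Q q' p'') → Q q p)

/-- `q` and `p` are branching apart: related by every branching apartness. -/
def BApart {X A : Type*} (tau : X → X → Prop) (step : A → X → X → Prop) (q p : X) : Prop :=
  ∀ Q, IsBranchingApartness tau step Q → Q q p

/-- A visible step for `some a`, at most one silent step for `none`. -/
def OptStep {X A : Type*} (tau : X → X → Prop) (step : A → X → X → Prop) :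
    Option A → X → X → Prop
  | none => Relation.ReflGen tau
  | some a => step a

/-- Semi-branching bisimulations, which, unlike branching bisimulations, compose. -/
def IsSemiBranchingBisim {X A : Type*} (tau : X → X → Prop) (step : A → X → X → Prop)
    (R : X → X → Prop) : Prop :=
  (∀ q p, R q p → R p q) ∧
  ∀ u q q' p, R q p → OptStep tau step u q q' →
    ∃ p' p'', TauCl tau p p' ∧ OptStep tau step u p' p'' ∧ R q p' ∧ R q' p''

/-- The largest semi-branching bisimulation. -/
def SemiBisimilar {X A : Type*} (tau : X → X → Prop) (step : A → X → X → Prop)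
    (q p : X) : Prop :=
  ∃ R, IsSemiBranchingBisim tau step R ∧ R q p

section

variable {X A : Type*} {tau : X → X → Prop} {step : A → X → X → Prop}

theorem TauCl.tail_reflGen {p r s : X} (h : TauCl tau p r) (h' : Relation.ReflGen tau r s) :
    TauCl tau p s :=
  Relation.ReflTransGen.trans h h'.to_reflTransGen

theorem IsSemiBranchingBisim.exists_tauCl {R : X → X → Prop}
    (hR : IsSemiBranchingBisim tau step R) {q q' p : X} (h : R q p) (hq : TauCl tau q q') :
    ∃ p', TauCl tau p p' ∧ R q' p' := by
  induction hq with
  | refl => exact ⟨p, .refl, h⟩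
  | tail _ hs ih =>
    obtain ⟨r, hpr, hr⟩ := ih
    obtain ⟨s, t, hrs, hst, -, ht⟩ := hR.2 none _ _ _ hr (Relation.ReflGen.single hs)
    exact ⟨t, TauCl.tail_reflGen (Relation.ReflTransGen.trans hpr hrs) hst, ht⟩

theorem IsSemiBranchingBisim.transGen {R : X → X → Prop}
    (hR : IsSemiBranchingBisim tau step R) :
    IsSemiBranchingBisim tau step (Relation.TransGen R) := by
  constructor
  · intro q p h
    induction h with
    | single h => exact .single (hR.1 _ _ h)
    | tail _ h ih => exact .head (hR.1 _ _ h) ih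
  · intro u q q' p h hs
    induction h with
    | single h =>
      obtain ⟨p', p'', h₁, h₂, h₃, h₄⟩ := hR.2 u _ _ _ h hs
      exact ⟨p', p'', h₁, h₂, .single h₃, .single h₄⟩
    | tail _ h ih =>
      obtain ⟨m', m'', h₁, h₂, h₃, h₄⟩ := ih
      obtain ⟨r, hr, hmr⟩ := hR.exists_tauCl h h₁
      obtain ⟨p', p'', k₁, k₂, k₃, k₄⟩ := hR.2 u _ _ _ hmr h₂
      exact ⟨p', p'', Relation.ReflTransGen.trans hr k₁, k₂, h₃.tail k₃, h₄.tail k₄⟩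

theorem isSemiBranchingBisim_eq : IsSemiBranchingBisim tau step Eq := by
  refine ⟨fun _ _ h => h.symm, ?_⟩
  rintro u q q' _ rfl hs
  exact ⟨q, q', .refl, hs, rfl, rfl⟩

theorem isSemiBranchingBisim_semiBisimilar :
    IsSemiBranchingBisim tau step (SemiBisimilar tau step) := by
  constructor
  · rintro q p ⟨R, hR, h⟩
    exact ⟨R, hR, hR.1 _ _ h⟩
  · rintro u q q' p ⟨R, hR, h⟩ hs
    obtain ⟨p', p'', h₁, h₂, h₃, h₄⟩ := hR.2 u _ _ _ h hs
    exact ⟨p', p'', h₁, h₂, ⟨R, hR, h₃⟩, ⟨R, hR, h₄⟩⟩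

theorem SemiBisimilar.refl (q : X) : SemiBisimilar tau step q q :=
  ⟨Eq, isSemiBranchingBisim_eq, rfl⟩

theorem SemiBisimilar.symm {q p : X} (h : SemiBisimilar tau step q p) :
    SemiBisimilar tau step p q :=
  isSemiBranchingBisim_semiBisimilar.1 _ _ h

theorem SemiBisimilar.trans {q r p : X} (h : SemiBisimilar tau step q r)
    (h' : SemiBisimilar tau step r p) : SemiBisimilar tau step q p :=
  ⟨_, isSemiBranchingBisim_semiBisimilar.transGen, .tail (.single h) h'⟩

/-- The stuttering property. -/
theorem SemiBisimilar.stutter {p r s : X} (hpr : TauCl tau p r) (hrs : TauCl tau r s)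
    (h : SemiBisimilar tau step p s) : SemiBisimilar tau step p r := by
  let V : X → X → Prop := fun x y =>
    ∃ z, TauCl tau x y ∧ TauCl tau y z ∧ SemiBisimilar tau step x z
  refine ⟨fun x y => SemiBisimilar tau step x y ∨ V x y ∨ V y x, ⟨?_, ?_⟩,
    .inr (.inl ⟨s, hpr, hrs, h⟩)⟩
  · rintro x y (h | h | h)
    · exact .inl h.symm
    · exact .inr (.inr h)
    · exact .inr (.inl h)
  · rintro u x x' y (h | ⟨z, -, hyz, h⟩ | ⟨z, hyx, -, -⟩) hs
    · obtain ⟨a, b, h₁, h₂, h₃, h₄⟩ := isSemiBranchingBisim_semiBisimilar.2 u _ _ _ h hs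
      exact ⟨a, b, h₁, h₂, .inl h₃, .inl h₄⟩
    · obtain ⟨a, b, h₁, h₂, h₃, h₄⟩ := isSemiBranchingBisim_semiBisimilar.2 u _ _ _ h hs
      exact ⟨a, b, Relation.ReflTransGen.trans hyz h₁, h₂, .inl h₃, .inl h₄⟩
    · exact ⟨x, x', hyx, hs, .inl (.refl x), .inl (.refl x')⟩

theorem isBranchingApartness_not_semiBisimilar :
    IsBranchingApartness tau step (fun q p => ¬ SemiBisimilar tau step q p) := by
  refine ⟨fun q p h h' => h h'.symm, ?_, ?_⟩
  · intro q q' p hs hq' hall h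
    obtain ⟨p', p'', h₁, h₂, h₃, h₄⟩ :=
      isSemiBranchingBisim_semiBisimilar.2 none _ _ _ h (Relation.ReflGen.single hs)
    rcases h₂ with _ | h₂
    · rcases Relation.ReflTransGen.cases_tail h₁ with rfl | ⟨r, hpr, hrp⟩
      · exact hq' h₄
      · have hr := SemiBisimilar.stutter hpr (.single hrp) (h.symm.trans h₃)
        exact (hall r p' hpr hrp).elim (fun k => k (h.trans hr)) (fun k => k h₄)
    · exact (hall p' p'' h₁ h₂).elim (fun k => k h₃) (fun k => k h₄)
  · intro q q' p a hs hall h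
    obtain ⟨p', p'', h₁, h₂, h₃, h₄⟩ :=
      isSemiBranchingBisim_semiBisimilar.2 (some a) _ _ _ h hs
    exact (hall p' p'' h₁ h₂).elim (fun k => k h₃) (fun k => k h₄)

theorem isBranchingApartness_bApart : IsBranchingApartness tau step (BApart tau step) := by
  refine ⟨fun q p h Q hQ => hQ.1 _ _ (h Q hQ), ?_, ?_⟩
  · intro q q' p hs hq' hall Q hQ
    exact hQ.2.1 q q' p hs (hq' Q hQ) fun p' p'' h₁ h₂ =>
      (hall p' p'' h₁ h₂).imp (fun k => k Q hQ) (fun k => k Q hQ)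
  · intro q q' p a hs hall Q hQ
    exact hQ.2.2 q q' p a hs fun p' p'' h₁ h₂ =>
      (hall p' p'' h₁ h₂).imp (fun k => k Q hQ) (fun k => k Q hQ)

theorem IsBranchingApartness.isSemiBranchingBisim_not {Q : X → X → Prop}
    (hQ : IsBranchingApartness tau step Q) :
    IsSemiBranchingBisim tau step (fun q p => ¬ Q q p) := by
  refine ⟨fun q p h h' => h (hQ.1 _ _ h'), ?_⟩
  rintro (_ | a) q q' p h hs
  · rcases hs with _ | hs
    · exact ⟨p, p, .refl, Relation.ReflGen.refl, h, h⟩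
    · by_contra! hcon
      have hq' : Q q' p := hcon p p .refl Relation.ReflGen.refl h
      exact h (hQ.2.1 q q' p hs hq' fun p' p'' h₁ h₂ =>
        or_iff_not_imp_left.2 (hcon p' p'' h₁ (Relation.ReflGen.single h₂)))
  · by_contra! hcon
    exact h (hQ.2.2 q q' p a hs fun p' p'' h₁ h₂ =>
      or_iff_not_imp_left.2 (hcon p' p'' h₁ h₂))

theorem bApart_iff_not_semiBisimilar {q p : X} :
    BApart tau step q p ↔ ¬ SemiBisimilar tau step q p :=
  ⟨fun h => h _ isBranchingApartness_not_semiBisimilar, fun h => by_contra fun h' =>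
    h ⟨_, isBranchingApartness_bApart.isSemiBranchingBisim_not, h'⟩⟩

theorem BApart.cotrans {q p : X} (h : BApart tau step q p) (r : X) :
    BApart tau step q r ∨ BApart tau step r p := by
  simp only [bApart_iff_not_semiBisimilar] at h ⊢
  by_contra! hcon
  exact h (hcon.1.trans hcon.2)

end

theorem bApart_alternative_rule {X A : Type*} (tau : X → X → Prop)
    (step : A → X → X → Prop) (q q' p : X) (a : A) (hstep : step a q q')
    (h : ∀ p' p'', TauCl tau p p' → step a p' p'' →
      BApart tau step p p' ∨ BApart tau step q' p'') :
    BApart tau step q p := by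
  by_contra hqp
  refine hqp (isBranchingApartness_bApart.2.2 q q' p a hstep fun p' p'' h₁ h₂ => ?_)
  refine (h p' p'' h₁ h₂).imp_left fun hp => ?_
  exact (hp.cotrans q).resolve_left fun k => hqp (isBranchingApartness_bApart.1 _ _ k)
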